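/- arXiv:2605.00771 — 6 statements merged into one kernel-verified Lean document; each statement's English description precedes it below -/
import Mathlib

section
/- In the reciprocal dyadic network model with symmetric mutual-utility covariates, define agent i's utility U_i(g) = Σ_{j≠i} [ g i j · ⟨X i j, β⟩ + g i j · g j i · ⟨Z i j, ρ⟩ + g i j · (α i + γ j) ] and the potential function Φ(g) = Σ_{i≠j} g i j · (⟨X i j, β⟩ + α i + γ j) + Σ_{i<j} g i j · g j i · ⟨Z i j, ρ⟩. Then for every ordered pair of distinct agents (i, j) and every two adjacency matrices g and g' that agree in all entries except possibly the entry (i, j), one has U_i(g) − U_i(g') = Φ(g) − Φ(g'). -/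
/-!
STATEMENT 0: Potential-game identity for the reciprocal dyadic network model.
For any ordered pair of distinct agents (i, j) and any two adjacency matrices
g, g' that agree in all entries except possibly the entry (i, j),
U_i(g) − U_i(g') = Φ(g) − Φ(g').
-/

noncomputable section
open Finset

/-- Euclidean inner product on `Fin d → ℝ`. -/
def dotp {d : ℕ} (v w : Fin d → ℝ) : ℝ := ∑ k, v k * w k

/-- Agent `i`'s utility:
`U_i(g) = Σ_{j≠i} [ g i j ⟨X i j, β⟩ + g i j g j i ⟨Z i j, ρ⟩ + g i j (α i + γ j) ]`. -/
def utility {n dx dz : ℕ} (X : Fin n → Fin n → Fin dx → ℝ)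
    (Z : Fin n → Fin n → Fin dz → ℝ) (β : Fin dx → ℝ) (ρ : Fin dz → ℝ)
    (α γ : Fin n → ℝ) (g : Fin n → Fin n → ℝ) (i : Fin n) : ℝ :=
  ∑ j ∈ univ \ {i},
    (g i j * dotp (X i j) β + g i j * g j i * dotp (Z i j) ρ + g i j * (α i + γ j))

/-- The potential function
`Φ(g) = Σ_{i≠j} g i j (⟨X i j, β⟩ + α i + γ j) + Σ_{i<j} g i j g j i ⟨Z i j, ρ⟩`. -/
def potential {n dx dz : ℕ} (X : Fin n → Fin n → Fin dx → ℝ)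
    (Z : Fin n → Fin n → Fin dz → ℝ) (β : Fin dx → ℝ) (ρ : Fin dz → ℝ)
    (α γ : Fin n → ℝ) (g : Fin n → Fin n → ℝ) : ℝ :=
  (∑ i, ∑ j ∈ univ \ {i}, g i j * (dotp (X i j) β + α i + γ j))
    + ∑ i, ∑ j ∈ univ.filter (fun j => i < j), g i j * g j i * dotp (Z i j) ρ

/-- Two sums whose summands agree off a single index differ by the summands there. -/
theorem sum_sub_sum_eq_of_eq_off {ι M : Type*} [AddCommGroup M] {s : Finset ι} {a : ι}
    (ha : a ∈ s) {f h : ι → M} (hfh : ∀ x ∈ s, x ≠ a → f x = h x) :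
    ∑ x ∈ s, f x - ∑ x ∈ s, h x = f a - h a := by
  rw [← sum_sub_distrib]
  exact sum_eq_single_of_mem a ha fun x hx hxa => sub_eq_zero.mpr (hfh x hx hxa)

/-- Two double sums whose summands agree off a single pair differ by the summands there. -/
theorem sum_sum_sub_sum_sum_eq_of_eq_off {ι κ M : Type*} [Fintype ι] [AddCommGroup M]
    {s : ι → Finset κ} {a : ι} {b : κ} (hb : b ∈ s a) {f h : ι → κ → M}
    (hfh : ∀ x, ∀ y ∈ s x, (x, y) ≠ (a, b) → f x y = h x y) :
    ∑ x, ∑ y ∈ s x, f x y - ∑ x, ∑ y ∈ s x, h x y = f a b - h a b := by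
  rw [sum_sub_sum_eq_of_eq_off (mem_univ a), sum_sub_sum_eq_of_eq_off hb]
  · exact fun y hy hyb => hfh a y hy (by simp [hyb])
  · exact fun x _ hxa => sum_congr rfl fun y hy => hfh x y hy (by simp [hxa])

theorem potential_game_identity {n dx dz : ℕ} (hn : 2 ≤ n) (hdx : 1 ≤ dx) (hdz : 1 ≤ dz)
    (X : Fin n → Fin n → Fin dx → ℝ) (Z : Fin n → Fin n → Fin dz → ℝ)
    (hZsymm : ∀ i j, Z i j = Z j i)
    (β : Fin dx → ℝ) (ρ : Fin dz → ℝ) (α γ : Fin n → ℝ)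
    (g g' : Fin n → Fin n → ℝ)
    (hg01 : ∀ i j, g i j = 0 ∨ g i j = 1) (hg'01 : ∀ i j, g' i j = 0 ∨ g' i j = 1)
    (hgdiag : ∀ i, g i i = 0) (hg'diag : ∀ i, g' i i = 0)
    (i j : Fin n) (hij : i ≠ j)
    (hagree : ∀ k l : Fin n, (k, l) ≠ (i, j) → g k l = g' k l) :
    utility X Z β ρ α γ g i - utility X Z β ρ α γ g' i
      = potential X Z β ρ α γ g - potential X Z β ρ α γ g' := by
  have hji : g j i = g' j i := hagree j i (by simp [hij.symm])
  have hmem : j ∈ univ \ {i} := by simp [hij.symm]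
  have hU : utility X Z β ρ α γ g i - utility X Z β ρ α γ g' i =
      (g i j * dotp (X i j) β + g i j * g j i * dotp (Z i j) ρ + g i j * (α i + γ j)) -
      (g' i j * dotp (X i j) β + g' i j * g' j i * dotp (Z i j) ρ + g' i j * (α i + γ j)) := by
    refine sum_sub_sum_eq_of_eq_off hmem fun l _ hlj => ?_
    rw [hagree i l (by simp [hlj]), hagree l i (by simp [hij])]
  have hdirect := sum_sum_sub_sum_sum_eq_of_eq_off (s := fun k => univ \ {k}) hmem
    (f := fun k l => g k l * (dotp (X k l) β + α k + γ l))
    (h := fun k l => g' k l * (dotp (X k l) β + α k + γ l))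
    fun k l _ hkl => by simp only [hagree k l hkl]
  have hmutual :
      (∑ k, ∑ l ∈ univ.filter (fun l => k < l), g k l * g l k * dotp (Z k l) ρ) -
        ∑ k, ∑ l ∈ univ.filter (fun l => k < l), g' k l * g' l k * dotp (Z k l) ρ =
      g i j * g j i * dotp (Z i j) ρ - g' i j * g' j i * dotp (Z i j) ρ := by
    rcases hij.lt_or_gt with hlt | hgt
    · refine sum_sum_sub_sum_sum_eq_of_eq_off (a := i) (b := j)
        (s := fun k => univ.filter (fun l => k < l)) (by simpa using hlt)
        (f := fun k l => g k l * g l k * dotp (Z k l) ρ)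
        (h := fun k l => g' k l * g' l k * dotp (Z k l) ρ) fun k l hl hkl => ?_
      have hkl' : k < l := by simpa using hl
      have hlk : (l, k) ≠ (i, j) := by
        rintro ⟨⟩
        exact hlt.asymm hkl'
      simp only [hagree k l hkl, hagree l k hlk]
    · rw [sum_sum_sub_sum_sum_eq_of_eq_off (a := j) (b := i)
        (s := fun k => univ.filter (fun l => k < l)) (by simpa using hgt)
        (f := fun k l => g k l * g l k * dotp (Z k l) ρ)
        (h := fun k l => g' k l * g' l k * dotp (Z k l) ρ), hZsymm j i]
      · ring
      · intro k l hl hkl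
        have hkl' : k < l := by simpa using hl
        have hne : (k, l) ≠ (i, j) := by
          rintro ⟨⟩
          exact hgt.asymm hkl'
        have hlk : (l, k) ≠ (i, j) := by
          rintro ⟨⟩
          exact hkl rfl
        simp only [hagree k l hne, hagree l k hlk]
  rw [hU]
  unfold potential
  linear_combination -hdirect - hmutual
end
end

section
/- π is a stationary distribution of the dyadic logit dynamics: π(s) > 0 for every state s, Σ_{s} π(s) = 1, and Σ_{s} π(s) · P(s, s') = π(s') for every state s' ∈ {0,1} × {0,1}. -/
/-!
STATEMENT 2: π is a stationary distribution of the dyadic logit dynamics: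
π(s) > 0 for every state s, Σ_s π(s) = 1, and Σ_s π(s) · P(s, s') = π(s') for every s'.
-/

/-!
STATEMENT 1: The dyadic logit dynamics satisfy detailed balance with respect to π:
for all states s, s' ∈ {0,1} × {0,1}, π(s) · P(s, s') = π(s') · P(s', s).
-/

noncomputable section
open Real

/-- Numerical value of a binary coordinate. -/
def ind (b : Bool) : ℝ := if b then 1 else 0

/-- Logistic function σ(x) = exp x / (1 + exp x). -/
def sigm (x : ℝ) : ℝ := exp x / (1 + exp x)

/-- Transition matrix of the dyadic logit dynamics on {0,1} × {0,1}: with probability `q`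
the first coordinate is refreshed (to 1 with probability σ(B + b·C)), with probability
`1 − q` the second coordinate is refreshed (to 1 with probability σ(B' + a·C));
contributions of the two refresh moves to the same target state add. -/
def Pmat (B B' C q : ℝ) : Matrix (Bool × Bool) (Bool × Bool) ℝ := fun s s' =>
  q * (if s'.2 = s.2 then
        (if s'.1 then sigm (B + ind s.2 * C) else 1 - sigm (B + ind s.2 * C)) else 0)
  + (1 - q) * (if s'.1 = s.1 then
        (if s'.2 then sigm (B' + ind s.1 * C) else 1 - sigm (B' + ind s.1 * C)) else 0)

/-- Stationary dyadic distribution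
π(a,b) = exp(a·B + b·B' + a·b·C) / (1 + exp B + exp B' + exp(B + B' + C)). -/
def piDist (B B' C : ℝ) (s : Bool × Bool) : ℝ :=
  exp (ind s.1 * B + ind s.2 * B' + ind s.1 * ind s.2 * C)
    / (1 + exp B + exp B' + exp (B + B' + C))


theorem piDist_pos (B B' C : ℝ) (s : Bool × Bool) : 0 < piDist B B' C s := by
  unfold piDist
  positivity

theorem sum_piDist (B B' C : ℝ) : ∑ s : Bool × Bool, piDist B B' C s = 1 := by
  have hZ : 1 + exp B + exp B' + exp (B + B' + C) ≠ 0 := by positivity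
  simp only [piDist, ← Finset.sum_div]
  rw [div_eq_one_iff_eq hZ]
  simp [Fintype.sum_prod_type, ind]
  ring

theorem one_sub_sigm (x : ℝ) : 1 - sigm x = 1 / (1 + exp x) := by
  unfold sigm
  field_simp
  ring

theorem sum_Pmat (B B' C q : ℝ) (s : Bool × Bool) :
    ∑ s' : Bool × Bool, Pmat B B' C q s s' = 1 := by
  obtain ⟨a, b⟩ := s
  cases a <;> cases b <;> simp [Fintype.sum_prod_type, Pmat] <;> ring

/-- Detailed balance of the dyadic logit dynamics with respect to `piDist`. -/
theorem piDist_mul_Pmat_comm (B B' C q : ℝ) (s s' : Bool × Bool) :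
    piDist B B' C s * Pmat B B' C q s s' = piDist B B' C s' * Pmat B B' C q s' s := by
  obtain ⟨a, b⟩ := s
  obtain ⟨a', b'⟩ := s'
  cases a <;> cases b <;> cases a' <;> cases b' <;>
    simp [Pmat, piDist, ind, one_sub_sigm] <;>
    simp only [sigm, exp_add] <;>
    field_simp

theorem pi_stationary (B B' C q : ℝ) (hq0 : 0 < q) (hq1 : q < 1) :
    (∀ s : Bool × Bool, 0 < piDist B B' C s) ∧
    (∑ s : Bool × Bool, piDist B B' C s = 1) ∧
    (∀ s' : Bool × Bool, ∑ s : Bool × Bool, piDist B B' C s * Pmat B B' C q s s'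
      = piDist B B' C s') := by
  refine ⟨piDist_pos B B' C, sum_piDist B B' C, fun s' => ?_⟩
  simp_rw [piDist_mul_Pmat_comm B B' C q _ s', ← Finset.mul_sum, sum_Pmat, mul_one]
end
end

section
/- The stationary distribution of the dyadic logit dynamics is unique: if v : {0,1} × {0,1} → ℝ satisfies v(s) ≥ 0 for all s, Σ_{s} v(s) = 1, and Σ_{s} v(s) · P(s, s') = v(s') for all s', then v = π. -/
/-!
STATEMENT 3: The stationary distribution of the dyadic logit dynamics is unique:
if v ≥ 0, Σ_s v(s) = 1, and Σ_s v(s)·P(s,s') = v(s') for all s', then v = π.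
-/

/-!
STATEMENT 1: The dyadic logit dynamics satisfy detailed balance with respect to π:
for all states s, s' ∈ {0,1} × {0,1}, π(s) · P(s, s') = π(s') · P(s', s).
-/

noncomputable section
open Real

theorem ratio_eq_of_reversible_of_stationary {S : Type*} [Fintype S]
    {P : S → S → ℝ} {p v : S → ℝ} (hp : ∀ s, 0 < p s) (hP : ∀ s t, 0 ≤ P s t)
    (hrow : ∀ s, ∑ t, P s t = 1) (hrev : ∀ s t, p s * P s t = p t * P t s)
    (hstat : ∀ t, ∑ s, v s * P s t = v t) {s t : S} (hst : 0 < P s t) :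
    v s / p s = v t / p t := by
  set u : S → ℝ := fun s => v s / p s
  have hv : ∀ s, v s = p s * u s := fun s => (mul_div_cancel₀ (v s) (hp s).ne').symm
  have hleft : ∑ s, ∑ t, p s * P s t * u s ^ 2 = ∑ s, p s * u s ^ 2 := by
    refine Finset.sum_congr rfl fun s _ => ?_
    rw [← Finset.sum_mul, ← Finset.mul_sum, hrow, mul_one]
  have hright : ∑ s, ∑ t, p s * P s t * u t ^ 2 = ∑ s, p s * u s ^ 2 := by
    rw [Finset.sum_comm, ← hleft]
    exact Finset.sum_congr rfl fun s _ => Finset.sum_congr rfl fun t _ => by rw [hrev t s]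
  have hcross : ∑ s, ∑ t, p s * P s t * (u s * u t) = ∑ s, p s * u s ^ 2 := by
    rw [Finset.sum_comm]
    refine Finset.sum_congr rfl fun t _ => ?_
    calc ∑ s, p s * P s t * (u s * u t) = (∑ s, v s * P s t) * u t := by
          rw [Finset.sum_mul]
          exact Finset.sum_congr rfl fun s _ => by rw [hv s]; ring
      _ = p t * u t ^ 2 := by rw [hstat, hv t]; ring
  have henergy : ∑ s, ∑ t, p s * P s t * (u s - u t) ^ 2 = 0 := by
    have hexpand : ∀ s t, p s * P s t * (u s - u t) ^ 2 =
        p s * P s t * u s ^ 2 + p s * P s t * u t ^ 2 - 2 * (p s * P s t * (u s * u t)) :=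
      fun s t => by ring
    simp only [hexpand, Finset.sum_sub_distrib, Finset.sum_add_distrib, ← Finset.mul_sum]
    rw [hleft, hright, hcross]
    ring
  have hterm : ∀ s t, 0 ≤ p s * P s t * (u s - u t) ^ 2 := fun s t =>
    mul_nonneg (mul_nonneg (hp s).le (hP s t)) (sq_nonneg _)
  have hs := (Finset.sum_eq_zero_iff_of_nonneg fun s _ =>
    Finset.sum_nonneg fun t _ => hterm s t).1 henergy s (Finset.mem_univ s)
  have hzero := (Finset.sum_eq_zero_iff_of_nonneg fun t _ => hterm s t).1 hs t (Finset.mem_univ t)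
  have hsq := (mul_eq_zero.1 hzero).resolve_left (mul_pos (hp s) hst).ne'
  exact sub_eq_zero.1 (pow_eq_zero_iff two_ne_zero |>.1 hsq)

theorem sigm_pos (x : ℝ) : 0 < sigm x := by
  unfold sigm
  positivity

theorem sigm_lt_one (x : ℝ) : sigm x < 1 := by
  unfold sigm
  rw [div_lt_one (by positivity)]
  linarith

theorem Pmat_nonneg (B B' C : ℝ) {q : ℝ} (hq0 : 0 ≤ q) (hq1 : q ≤ 1) (s t : Bool × Bool) :
    0 ≤ Pmat B B' C q s t := by
  have h1 := sigm_pos (B + ind s.2 * C)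
  have h2 := sigm_lt_one (B + ind s.2 * C)
  have h3 := sigm_pos (B' + ind s.1 * C)
  have h4 := sigm_lt_one (B' + ind s.1 * C)
  unfold Pmat
  refine add_nonneg (mul_nonneg hq0 ?_) (mul_nonneg (by linarith) ?_) <;>
    split_ifs <;> linarith

theorem Pmat_row_sum (B B' C q : ℝ) (s : Bool × Bool) : ∑ t, Pmat B B' C q s t = 1 := by
  obtain ⟨a, b⟩ := s
  cases a <;> cases b <;> simp [Fintype.sum_prod_type, Pmat] <;> ring

theorem piDist_sum (B B' C : ℝ) : ∑ s, piDist B B' C s = 1 := by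
  have h : 1 + exp B + exp B' + exp (B + B' + C) ≠ 0 := by positivity
  simp only [Fintype.sum_prod_type, Fintype.sum_bool, piDist, ind]
  simp
  field_simp
  ring

theorem piDist_detailed_balance (B B' C q : ℝ) (s t : Bool × Bool) :
    piDist B B' C s * Pmat B B' C q s t = piDist B B' C t * Pmat B B' C q t s := by
  obtain ⟨a, b⟩ := s
  obtain ⟨c, d⟩ := t
  cases a <;> cases b <;> cases c <;> cases d <;>
    simp [piDist, Pmat, ind, sigm, exp_add] <;> field_simp <;> ring

theorem stationary_unique (B B' C q : ℝ) (hq0 : 0 < q) (hq1 : q < 1)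
    (v : Bool × Bool → ℝ)
    (hnonneg : ∀ s, 0 ≤ v s)
    (hsum : ∑ s : Bool × Bool, v s = 1)
    (hstat : ∀ s' : Bool × Bool, ∑ s : Bool × Bool, v s * Pmat B B' C q s s' = v s') :
    v = piDist B B' C := by
  have hratio : ∀ s t, 0 < Pmat B B' C q s t →
      v s / piDist B B' C s = v t / piDist B B' C t := fun s t =>
    ratio_eq_of_reversible_of_stationary (piDist_pos B B' C)
      (Pmat_nonneg B B' C hq0.le hq1.le) (Pmat_row_sum B B' C q)
      (piDist_detailed_balance B B' C q) hstat
  have hfst : ∀ b, v (false, b) / piDist B B' C (false, b) =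
      v (true, b) / piDist B B' C (true, b) := fun b =>
    hratio _ _ (by simpa [Pmat] using mul_pos hq0 (sigm_pos _))
  have hsnd : ∀ a, v (a, false) / piDist B B' C (a, false) =
      v (a, true) / piDist B B' C (a, true) := fun a =>
    hratio _ _ (by simpa [Pmat] using mul_pos (sub_pos.2 hq1) (sigm_pos _))
  obtain ⟨k, hk⟩ : ∃ k, ∀ s, v s / piDist B B' C s = k := by
    refine ⟨v (true, true) / piDist B B' C (true, true), ?_⟩
    rintro ⟨a, b⟩
    cases a
    · rw [hfst]
      cases b
      · exact hsnd true
      · rfl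
    · cases b
      · exact hsnd true
      · rfl
  have hv : ∀ s, v s = k * piDist B B' C s := fun s =>
    (div_eq_iff (piDist_pos B B' C s).ne').1 (hk s)
  have hk1 : k = 1 := by
    simpa only [hv, ← Finset.mul_sum, piDist_sum, mul_one] using hsum
  funext s
  rw [hv, hk1, one_mul]
end
end

section
/- Exponential family decomposition of the log-likelihood: in the reciprocal dyadic network model, ℓ = Σ_{i≠j} g i j · ⟨X i j, β⟩ + Σ_{i<j} g i j · g j i · ⟨Z i j, ρ⟩ + Σ_i d_i · α i + Σ_i b_i · γ i − Σ_{i≠j} (1/2)·ln(Denom i j), where d_i = Σ_{j≠i} g i j is the out-degree and b_i = Σ_{j≠i} g j i is the in-degree of node i. -/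
/-!
STATEMENT 10: Exponential family decomposition of the log-likelihood:
ℓ = Σ_{i≠j} g i j ⟨X i j, β⟩ + Σ_{i<j} g i j g j i ⟨Z i j, ρ⟩ + Σ_i d_i α i + Σ_i b_i γ i
    − Σ_{i≠j} (1/2) ln(Denom i j),
where d_i = Σ_{j≠i} g i j (out-degree) and b_i = Σ_{j≠i} g j i (in-degree).
-/

noncomputable section
open Real Finset

/-- `B i j = ⟨X i j, β⟩ + α i + γ j`. -/
def Bmat {n dx : ℕ} (X : Fin n → Fin n → Fin dx → ℝ) (β : Fin dx → ℝ)
    (α γ : Fin n → ℝ) (i j : Fin n) : ℝ := dotp (X i j) β + α i + γ j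

/-- `C i j = ⟨Z i j, ρ⟩`. -/
def Cmat {n dz : ℕ} (Z : Fin n → Fin n → Fin dz → ℝ) (ρ : Fin dz → ℝ)
    (i j : Fin n) : ℝ := dotp (Z i j) ρ

/-- `Denom i j = 1 + exp(B i j) + exp(B j i) + exp(B i j + B j i + C i j)`. -/
def DenomM {n dx dz : ℕ} (X : Fin n → Fin n → Fin dx → ℝ)
    (Z : Fin n → Fin n → Fin dz → ℝ) (β : Fin dx → ℝ) (ρ : Fin dz → ℝ)
    (α γ : Fin n → ℝ) (i j : Fin n) : ℝ :=
  1 + exp (Bmat X β α γ i j) + exp (Bmat X β α γ j i)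
    + exp (Bmat X β α γ i j + Bmat X β α γ j i + Cmat Z ρ i j)

/-- Dyadic probability `π i j (a, b) = exp(a·B i j + b·B j i + a·b·C i j) / Denom i j`. -/
def piDyad {n dx dz : ℕ} (X : Fin n → Fin n → Fin dx → ℝ)
    (Z : Fin n → Fin n → Fin dz → ℝ) (β : Fin dx → ℝ) (ρ : Fin dz → ℝ)
    (α γ : Fin n → ℝ) (i j : Fin n) (a b : ℝ) : ℝ :=
  exp (a * Bmat X β α γ i j + b * Bmat X β α γ j i + a * b * Cmat Z ρ i j)
    / DenomM X Z β ρ α γ i j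

/-- Marginal link probability `p i j = π i j (1,0) + π i j (1,1)`. -/
def pmarg {n dx dz : ℕ} (X : Fin n → Fin n → Fin dx → ℝ)
    (Z : Fin n → Fin n → Fin dz → ℝ) (β : Fin dx → ℝ) (ρ : Fin dz → ℝ)
    (α γ : Fin n → ℝ) (i j : Fin n) : ℝ :=
  piDyad X Z β ρ α γ i j 1 0 + piDyad X Z β ρ α γ i j 1 1

/-- `p11 i j = π i j (1,1)`. -/
def p11M {n dx dz : ℕ} (X : Fin n → Fin n → Fin dx → ℝ)
    (Z : Fin n → Fin n → Fin dz → ℝ) (β : Fin dx → ℝ) (ρ : Fin dz → ℝ)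
    (α γ : Fin n → ℝ) (i j : Fin n) : ℝ :=
  piDyad X Z β ρ α γ i j 1 1

/-- Log-likelihood `ℓ = Σ_{i<j} ln(π i j (g i j, g j i))`. -/
def loglik {n dx dz : ℕ} (g : Fin n → Fin n → ℝ) (X : Fin n → Fin n → Fin dx → ℝ)
    (Z : Fin n → Fin n → Fin dz → ℝ) (β : Fin dx → ℝ) (ρ : Fin dz → ℝ)
    (α γ : Fin n → ℝ) : ℝ :=
  ∑ i, ∑ j ∈ univ.filter (fun j => i < j),
    log (piDyad X Z β ρ α γ i j (g i j) (g j i))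

/-- A sum over ordered pairs of distinct indices, grouped by unordered pairs. -/
theorem sum_sum_sdiff_singleton_eq_sum_lt {ι M : Type*} [Fintype ι] [LinearOrder ι]
    [AddCommMonoid M] (f : ι → ι → M) :
    ∑ i, ∑ j ∈ univ \ {i}, f i j = ∑ i, ∑ j ∈ univ.filter (fun j => i < j), (f i j + f j i) := by
  have hsplit (i : ι) : ∑ j ∈ univ \ {i}, f i j
      = ∑ j ∈ univ.filter (fun j => i < j), f i j + ∑ j ∈ univ.filter (fun j => j < i), f i j := by
    rw [← sum_union (disjoint_filter.2 fun j _ h => h.not_gt)]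
    congr 1
    ext j
    simp [eq_comm, ← ne_eq, lt_or_lt_iff_ne]
  have hswap : ∑ i, ∑ j ∈ univ.filter (fun j => j < i), f i j
      = ∑ i, ∑ j ∈ univ.filter (fun j => i < j), f j i :=
    sum_comm' (by simp)
  simp only [hsplit, sum_add_distrib, hswap]

theorem DenomM_pos {n dx dz : ℕ} (X : Fin n → Fin n → Fin dx → ℝ)
    (Z : Fin n → Fin n → Fin dz → ℝ) (β : Fin dx → ℝ) (ρ : Fin dz → ℝ)
    (α γ : Fin n → ℝ) (i j : Fin n) : 0 < DenomM X Z β ρ α γ i j := by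
  unfold DenomM
  positivity

theorem DenomM_comm {n dx dz : ℕ} (X : Fin n → Fin n → Fin dx → ℝ)
    {Z : Fin n → Fin n → Fin dz → ℝ} (hZsymm : ∀ i j, Z i j = Z j i)
    (β : Fin dx → ℝ) (ρ : Fin dz → ℝ) (α γ : Fin n → ℝ) (i j : Fin n) :
    DenomM X Z β ρ α γ i j = DenomM X Z β ρ α γ j i := by
  simp only [DenomM, Cmat, hZsymm i j, add_comm (Bmat X β α γ i j) (Bmat X β α γ j i)]
  ring

theorem log_piDyad {n dx dz : ℕ} (X : Fin n → Fin n → Fin dx → ℝ)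
    (Z : Fin n → Fin n → Fin dz → ℝ) (β : Fin dx → ℝ) (ρ : Fin dz → ℝ)
    (α γ : Fin n → ℝ) (i j : Fin n) (a b : ℝ) :
    log (piDyad X Z β ρ α γ i j a b)
      = a * Bmat X β α γ i j + b * Bmat X β α γ j i + a * b * Cmat Z ρ i j
        - log (DenomM X Z β ρ α γ i j) := by
  rw [piDyad, log_div (exp_ne_zero _) (DenomM_pos X Z β ρ α γ i j).ne', log_exp]

theorem expfamily_decomposition {n dx dz : ℕ} (hn : 2 ≤ n) (hdx : 1 ≤ dx) (hdz : 1 ≤ dz)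
    (g : Fin n → Fin n → ℝ) (X : Fin n → Fin n → Fin dx → ℝ)
    (Z : Fin n → Fin n → Fin dz → ℝ)
    (hgdiag : ∀ i, g i i = 0) (hg01 : ∀ i j, g i j = 0 ∨ g i j = 1)
    (hZsymm : ∀ i j, Z i j = Z j i)
    (β : Fin dx → ℝ) (ρ : Fin dz → ℝ) (α γ : Fin n → ℝ) :
    loglik g X Z β ρ α γ
      = (∑ i, ∑ j ∈ univ \ {i}, g i j * dotp (X i j) β)
        + (∑ i, ∑ j ∈ univ.filter (fun j => i < j), g i j * g j i * dotp (Z i j) ρ)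
        + (∑ i, (∑ j ∈ univ \ {i}, g i j) * α i)
        + (∑ i, (∑ j ∈ univ \ {i}, g j i) * γ i)
        - ∑ i, ∑ j ∈ univ \ {i}, (1 / 2) * log (DenomM X Z β ρ α γ i j) := by
  simp only [loglik, log_piDyad, sum_mul, sum_sum_sdiff_singleton_eq_sum_lt, ← sum_add_distrib,
    ← sum_sub_distrib]
  refine sum_congr rfl fun i _ => sum_congr rfl fun j _ => ?_
  rw [DenomM_comm X hZsymm β ρ α γ j i]
  simp only [Bmat, Cmat]
  ring
end
end

section
/- Lipschitz bound on the fixed-effects Hessian (Lemma A.2): in the reciprocal dyadic network model with normalization α of the last node = γ of the last node = 0, let H(θ, λ) denote the (2n−2)×(2n−2) matrix of second-order partial derivatives of the log-likelihood ℓ with respect to the fixed-effects vector λ = (α_1, γ_1, …, α_{n−1}, γ_{n−1}). Then for every parameter θ = (β, ρ) and all x, y, z ∈ ℝ^{2n−2}, ‖[H(θ, x) − H(θ, y)] z‖_∞ ≤ 4(n−1) · ‖x − y‖_∞ · ‖z‖_∞. -/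
/-!
STATEMENT 13 (Lemma A.2): Lipschitz bound on the fixed-effects Hessian: with
H(θ, λ) the matrix of second-order partial derivatives of ℓ with respect to the
fixed-effects vector λ = (α_1, γ_1, …, α_{n−1}, γ_{n−1}) (normalization
α_last = γ_last = 0), for all x, y, z, ‖[H(θ,x) − H(θ,y)] z‖_∞ ≤ 4(n−1)‖x−y‖_∞‖z‖_∞.
Nodes are indexed by `Fin (n+1)`, so the paper's 4(n−1) reads `4 * n`; the norm on
`Fin n × Bool → ℝ` is the sup norm.
-/

noncomputable section
open Real Finset

/-- Sender effects extracted from the fixed-effects vector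
`λ = (α_1, γ_1, …, α_{n−1}, γ_{n−1})` (coordinate `(i, false)` is `α i`),
with the normalization `α` of the last node `= 0`. -/
def alphaOf {n : ℕ} (lam : Fin n × Bool → ℝ) : Fin (n + 1) → ℝ := fun i =>
  if h : i = Fin.last n then 0 else lam (i.castPred h, false)

/-- Receiver effects extracted from the fixed-effects vector
(coordinate `(i, true)` is `γ i`), with the normalization `γ` of the last node `= 0`. -/
def gammaOf {n : ℕ} (lam : Fin n × Bool → ℝ) : Fin (n + 1) → ℝ := fun i =>
  if h : i = Fin.last n then 0 else lam (i.castPred h, true)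

/-- The log-likelihood as a function of the fixed-effects vector `λ ∈ ℝ^{2n}`. -/
def Lfun {n dx dz : ℕ} (g : Fin (n + 1) → Fin (n + 1) → ℝ)
    (X : Fin (n + 1) → Fin (n + 1) → Fin dx → ℝ)
    (Z : Fin (n + 1) → Fin (n + 1) → Fin dz → ℝ)
    (β : Fin dx → ℝ) (ρ : Fin dz → ℝ) (lam : Fin n × Bool → ℝ) : ℝ :=
  loglik g X Z β ρ (alphaOf lam) (gammaOf lam)

/-- The matrix of second-order partial derivatives of ℓ with respect to the
fixed-effects vector λ. -/
def Hess {n dx dz : ℕ} (g : Fin (n + 1) → Fin (n + 1) → ℝ)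
    (X : Fin (n + 1) → Fin (n + 1) → Fin dx → ℝ)
    (Z : Fin (n + 1) → Fin (n + 1) → Fin dz → ℝ)
    (β : Fin dx → ℝ) (ρ : Fin dz → ℝ) (lam : Fin n × Bool → ℝ) :
    Matrix (Fin n × Bool) (Fin n × Bool) ℝ := fun k l =>
  deriv (fun t : ℝ => deriv (fun s : ℝ =>
    Lfun g X Z β ρ (lam + t • (Pi.single k 1 : Fin n × Bool → ℝ) + s • (Pi.single l 1 : Fin n × Bool → ℝ))) 0) 0

section Gibbs

lemma hasDerivAt_exp_line {Ω : Type*} (c h : Ω → ℝ) (t : ℝ) (ω : Ω) :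
    HasDerivAt (fun s : ℝ => exp ((c + s • h) ω)) (exp ((c + t • h) ω) * h ω) t := by
  have h₁ : HasDerivAt (fun s : ℝ => (c + s • h) ω) (h ω) t := by
    simpa using ((hasDerivAt_id t).mul_const (h ω)).const_add (c ω)
  exact h₁.exp

variable {Ω : Type*} [Fintype Ω]

/-- Log-partition function of the scores `c`. -/
def logPartition (c : Ω → ℝ) : ℝ := log (∑ ω, exp (c ω))

/-- Expectation of `f` under the Gibbs distribution with scores `c`. -/
def gibbsMean (c f : Ω → ℝ) : ℝ := (∑ ω, exp (c ω) * f ω) / ∑ ω, exp (c ω)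

/-- Covariance of `f` and `h` under the Gibbs distribution with scores `c`. -/
def gibbsCov (c f h : Ω → ℝ) : ℝ := gibbsMean c (f * h) - gibbsMean c f * gibbsMean c h

lemma gibbsMean_add (c f h : Ω → ℝ) :
    gibbsMean c (f + h) = gibbsMean c f + gibbsMean c h := by
  simp [gibbsMean, mul_add, sum_add_distrib, add_div]

lemma gibbsMean_smul (c f : Ω → ℝ) (r : ℝ) : gibbsMean c (r • f) = r * gibbsMean c f := by
  simp only [gibbsMean, Pi.smul_apply, smul_eq_mul, mul_sum, mul_div_assoc', mul_left_comm]

lemma gibbsCov_add_right (c f h k : Ω → ℝ) :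
    gibbsCov c f (h + k) = gibbsCov c f h + gibbsCov c f k := by
  simp only [gibbsCov, mul_add, gibbsMean_add]; ring

lemma gibbsCov_smul_right (c f h : Ω → ℝ) (r : ℝ) :
    gibbsCov c f (r • h) = r * gibbsCov c f h := by
  simp only [gibbsCov, mul_smul_comm, gibbsMean_smul]; ring

/-- `gibbsCov` as a linear form in its last argument. -/
def gibbsCovLin (c f : Ω → ℝ) : (Ω → ℝ) →ₗ[ℝ] ℝ where
  toFun := gibbsCov c f
  map_add' := gibbsCov_add_right c f
  map_smul' r h := gibbsCov_smul_right c f h r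

lemma sum_exp_pos [Nonempty Ω] (c : Ω → ℝ) : 0 < ∑ ω, exp (c ω) :=
  sum_pos (fun _ _ => exp_pos _) univ_nonempty

variable [Nonempty Ω]

lemma hasDerivAt_logPartition (c h : Ω → ℝ) (t : ℝ) :
    HasDerivAt (fun s : ℝ => logPartition (c + s • h)) (gibbsMean (c + t • h) h) t :=
  (HasDerivAt.fun_sum fun ω _ => hasDerivAt_exp_line c h t ω).log (sum_exp_pos _).ne'

lemma hasDerivAt_gibbsMean (c h f : Ω → ℝ) (t : ℝ) :
    HasDerivAt (fun s : ℝ => gibbsMean (c + s • h) f) (gibbsCov (c + t • h) h f) t := by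
  have h₁ := HasDerivAt.fun_sum (u := univ) fun ω _ => hasDerivAt_exp_line c h t ω
  have h₂ := HasDerivAt.fun_sum (u := univ) fun ω _ =>
    (hasDerivAt_exp_line c h t ω).mul_const (f ω)
  have hpos := (sum_exp_pos (c + t • h)).ne'
  refine (h₂.fun_div h₁ hpos).congr_deriv ?_
  simp only [gibbsCov, gibbsMean, Pi.mul_apply, ← mul_assoc]
  field_simp

/-- Third central mixed moment under the Gibbs distribution with scores `c`. -/
def gibbsThird (c f h k : Ω → ℝ) : ℝ :=
  gibbsMean c fun ω =>
    (f ω - gibbsMean c f) * ((h ω - gibbsMean c h) * (k ω - gibbsMean c k))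

lemma gibbsMean_const (c : Ω → ℝ) (r : ℝ) : gibbsMean c (fun _ => r) = r := by
  rw [gibbsMean, ← sum_mul, mul_div_cancel_left₀ _ (sum_exp_pos c).ne']

lemma gibbsMean_mono (c : Ω → ℝ) {f h : Ω → ℝ} (hfh : ∀ ω, f ω ≤ h ω) :
    gibbsMean c f ≤ gibbsMean c h := by
  have := (sum_exp_pos c).le
  unfold gibbsMean
  gcongr with ω
  exact hfh ω

lemma gibbsThird_eq (c f h k : Ω → ℝ) :
    gibbsThird c f h k = gibbsCov c k (f * h) - (gibbsCov c k f * gibbsMean c h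
      + gibbsMean c f * gibbsCov c k h) := by
  unfold gibbsThird
  generalize hF : gibbsMean c f = F
  generalize hH : gibbsMean c h = H
  generalize hK : gibbsMean c k = K
  have : (fun ω => (f ω - F) * ((h ω - H) * (k ω - K)))
      = k * (f * h) + (-K) • (f * h) + (-H) • (k * f) + (-F) • (k * h)
        + (H * K) • f + (F * K) • h + (F * H) • k + fun _ => -(F * H * K) := by
    ext ω; simp; ring
  rw [this]
  simp only [gibbsMean_add, gibbsMean_smul, gibbsMean_const, gibbsCov, hF, hH, hK]
  ring

lemma hasDerivAt_gibbsCov (c f h k : Ω → ℝ) (t : ℝ) :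
    HasDerivAt (fun s : ℝ => gibbsCov (c + s • k) f h) (gibbsThird (c + t • k) f h k) t := by
  rw [gibbsThird_eq]
  exact (hasDerivAt_gibbsMean c k (f * h) t).sub
    ((hasDerivAt_gibbsMean c k f t).mul (hasDerivAt_gibbsMean c k h t))

lemma gibbsMean_sq_sub_le (c h : Ω → ℝ) {m R : ℝ} (hR : ∀ ω, |h ω - m| ≤ R) :
    gibbsMean c (fun ω => (h ω - gibbsMean c h) ^ 2) ≤ R ^ 2 := by
  have hle : gibbsMean c (fun ω => (h ω - m) ^ 2) ≤ R ^ 2 := by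
    rw [← gibbsMean_const c (R ^ 2)]
    exact gibbsMean_mono c fun ω => sq_le_sq' (abs_le.1 (hR ω)).1 (abs_le.1 (hR ω)).2
  have key : ∀ r : ℝ, gibbsMean c (fun ω => (h ω - r) ^ 2)
      = gibbsMean c (h * h) - 2 * r * gibbsMean c h + r ^ 2 := by
    intro r
    have : (fun ω => (h ω - r) ^ 2) = h * h + (-(2 * r)) • h + fun _ => r ^ 2 := by
      ext ω; simp; ring
    rw [this, gibbsMean_add, gibbsMean_add, gibbsMean_smul, gibbsMean_const]; ring
  rw [key] at hle ⊢
  nlinarith [sq_nonneg (gibbsMean c h - m)]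

lemma gibbsMean_mul_sq_le (c f h : Ω → ℝ) :
    gibbsMean c (f * h) ^ 2
      ≤ gibbsMean c (fun ω => f ω ^ 2) * gibbsMean c (fun ω => h ω ^ 2) := by
  unfold gibbsMean
  rw [div_pow, div_mul_div_comm, ← sq]
  gcongr
  refine sum_sq_le_sum_mul_sum_of_sq_le_mul _ (fun _ _ => by positivity)
    (fun _ _ => by positivity) fun ω _ => ?_
  simp only [Pi.mul_apply]
  exact le_of_eq (by ring)

lemma abs_gibbsThird_le (c f h k : Ω → ℝ) {F m R m' S : ℝ}
    (hf₀ : ∀ ω, 0 ≤ f ω) (hf₁ : ∀ ω, f ω ≤ F)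
    (hR : ∀ ω, |h ω - m| ≤ R) (hS : ∀ ω, |k ω - m'| ≤ S) :
    |gibbsThird c f h k| ≤ F * (R * S) := by
  obtain ⟨ω₀⟩ := ‹Nonempty Ω›
  have hF : 0 ≤ F := (hf₀ ω₀).trans (hf₁ ω₀)
  have hR₀ : 0 ≤ R := (abs_nonneg _).trans (hR ω₀)
  have hS₀ : 0 ≤ S := (abs_nonneg _).trans (hS ω₀)
  have hne : Nonempty Ω := ⟨ω₀⟩
  have hm₀ : 0 ≤ gibbsMean c f := by
    rw [← gibbsMean_const c 0]; exact gibbsMean_mono c hf₀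
  have hm₁ : gibbsMean c f ≤ F := by
    rw [← gibbsMean_const c F]; exact gibbsMean_mono c hf₁
  set a : Ω → ℝ := fun ω => |h ω - gibbsMean c h| with ha
  set b : Ω → ℝ := fun ω => |k ω - gibbsMean c k| with hb
  have hab : gibbsMean c (a * b) ≤ R * S := by
    refine le_of_sq_le_sq ?_ (by positivity)
    refine (gibbsMean_mul_sq_le c a b).trans ?_
    have h₁ := gibbsMean_sq_sub_le c h hR
    have h₂ := gibbsMean_sq_sub_le c k hS
    simp only [ha, hb, sq_abs]
    rw [mul_pow]
    refine mul_le_mul h₁ h₂ ?_ (by positivity)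
    rw [← gibbsMean_const c 0]; exact gibbsMean_mono c fun ω => sq_nonneg _
  have hpt : ∀ ω, |(f ω - gibbsMean c f) * ((h ω - gibbsMean c h) * (k ω - gibbsMean c k))|
      ≤ (F • (a * b)) ω := fun ω => by
    simp only [abs_mul, Pi.smul_apply, Pi.mul_apply, smul_eq_mul, ha, hb]
    gcongr
    rw [abs_le]
    constructor <;> linarith [hf₀ ω, hf₁ ω]
  have hup := gibbsMean_mono c fun ω => (abs_le.1 (hpt ω)).2
  have hlo := gibbsMean_mono c (f := (-1 : ℝ) • (F • (a * b))) fun ω => by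
    simpa using (abs_le.1 (hpt ω)).1
  rw [gibbsMean_smul] at hup
  rw [gibbsMean_smul, gibbsMean_smul] at hlo
  have := mul_le_mul_of_nonneg_left hab hF
  unfold gibbsThird
  rw [abs_le]
  constructor <;> linarith

lemma abs_gibbsCov_add_sub_le (c f h k : Ω → ℝ) {F m R m' S : ℝ}
    (hf₀ : ∀ ω, 0 ≤ f ω) (hf₁ : ∀ ω, f ω ≤ F)
    (hR : ∀ ω, |h ω - m| ≤ R) (hS : ∀ ω, |k ω - m'| ≤ S) :
    |gibbsCov (c + k) f h - gibbsCov c f h| ≤ F * (R * S) := by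
  have := norm_image_sub_le_of_norm_deriv_le_segment_01'
    (f := fun s : ℝ => gibbsCov (c + s • k) f h) (C := F * (R * S))
    (fun t _ => (hasDerivAt_gibbsCov c f h k t).hasDerivWithinAt)
    (fun t _ => abs_gibbsThird_le _ f h k hf₀ hf₁ hR hS)
  simpa using this

end Gibbs

section Dyads

variable {n dx dz : ℕ}

lemma alphaOf_add (v w : Fin n × Bool → ℝ) (i : Fin (n + 1)) :
    alphaOf (v + w) i = alphaOf v i + alphaOf w i := by
  unfold alphaOf; split <;> simp

lemma gammaOf_add (v w : Fin n × Bool → ℝ) (i : Fin (n + 1)) :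
    gammaOf (v + w) i = gammaOf v i + gammaOf w i := by
  unfold gammaOf; split <;> simp

lemma alphaOf_smul (r : ℝ) (v : Fin n × Bool → ℝ) (i : Fin (n + 1)) :
    alphaOf (r • v) i = r * alphaOf v i := by
  unfold alphaOf; split <;> simp

lemma gammaOf_smul (r : ℝ) (v : Fin n × Bool → ℝ) (i : Fin (n + 1)) :
    gammaOf (r • v) i = r * gammaOf v i := by
  unfold gammaOf; split <;> simp

lemma abs_alphaOf_le (v : Fin n × Bool → ℝ) (i : Fin (n + 1)) : |alphaOf v i| ≤ ‖v‖ := by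
  unfold alphaOf; split
  · simp
  · exact norm_le_pi_norm v _

lemma abs_gammaOf_le (v : Fin n × Bool → ℝ) (i : Fin (n + 1)) : |gammaOf v i| ≤ ‖v‖ := by
  unfold gammaOf; split
  · simp
  · exact norm_le_pi_norm v _

/-- Contribution of the fixed effects to the score of the dyad `(i, j)` in state `(a, b)`. -/
def dyadEffect (i j : Fin (n + 1)) (a b : ℝ) : (Fin n × Bool → ℝ) →ₗ[ℝ] ℝ where
  toFun v := a * (alphaOf v i + gammaOf v j) + b * (alphaOf v j + gammaOf v i)
  map_add' v w := by simp only [alphaOf_add, gammaOf_add]; ring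
  map_smul' r v := by
    simp only [alphaOf_smul, gammaOf_smul, smul_eq_mul, RingHom.id_apply]; ring

lemma dyadEffect_apply (i j : Fin (n + 1)) (a b : ℝ) (v : Fin n × Bool → ℝ) :
    dyadEffect i j a b v
      = a * (alphaOf v i + gammaOf v j) + b * (alphaOf v j + gammaOf v i) := rfl

/-- The effects of a dyad as a linear map into functions of its state. -/
def dyadEffects (i j : Fin (n + 1)) : (Fin n × Bool → ℝ) →ₗ[ℝ] (Bool × Bool → ℝ) :=
  LinearMap.pi fun ω => dyadEffect i j (if ω.1 then 1 else 0) (if ω.2 then 1 else 0)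

/-- Score of the dyad `(i, j)` in state `(a, b)`. -/
def dyadScore (X : Fin (n + 1) → Fin (n + 1) → Fin dx → ℝ)
    (Z : Fin (n + 1) → Fin (n + 1) → Fin dz → ℝ) (β : Fin dx → ℝ) (ρ : Fin dz → ℝ)
    (v : Fin n × Bool → ℝ) (i j : Fin (n + 1)) (a b : ℝ) : ℝ :=
  a * Bmat X β (alphaOf v) (gammaOf v) i j + b * Bmat X β (alphaOf v) (gammaOf v) j i
    + a * b * Cmat Z ρ i j

/-- Scores of the dyad `(i, j)` as a function of its state. -/
def dyadScores (X : Fin (n + 1) → Fin (n + 1) → Fin dx → ℝ)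
    (Z : Fin (n + 1) → Fin (n + 1) → Fin dz → ℝ) (β : Fin dx → ℝ) (ρ : Fin dz → ℝ)
    (v : Fin n × Bool → ℝ) (i j : Fin (n + 1)) (ω : Bool × Bool) : ℝ :=
  dyadScore X Z β ρ v i j (if ω.1 then 1 else 0) (if ω.2 then 1 else 0)

section Likelihood

variable (g : Fin (n + 1) → Fin (n + 1) → ℝ) (X : Fin (n + 1) → Fin (n + 1) → Fin dx → ℝ)
  (Z : Fin (n + 1) → Fin (n + 1) → Fin dz → ℝ) (β : Fin dx → ℝ) (ρ : Fin dz → ℝ)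

lemma dyadScore_add (v w : Fin n × Bool → ℝ) (i j : Fin (n + 1)) (a b : ℝ) :
    dyadScore X Z β ρ (v + w) i j a b
      = dyadScore X Z β ρ v i j a b + dyadEffect i j a b w := by
  simp only [dyadScore, Bmat, alphaOf_add, gammaOf_add, dyadEffect_apply]; ring

lemma dyadScores_add (v w : Fin n × Bool → ℝ) (i j : Fin (n + 1)) :
    dyadScores X Z β ρ (v + w) i j = dyadScores X Z β ρ v i j + dyadEffects i j w :=
  funext fun _ => dyadScore_add X Z β ρ v w i j _ _

lemma log_piDyad_s13 (v : Fin n × Bool → ℝ) (i j : Fin (n + 1)) (a b : ℝ) :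
    log (piDyad X Z β ρ (alphaOf v) (gammaOf v) i j a b)
      = dyadScore X Z β ρ v i j a b - logPartition (dyadScores X Z β ρ v i j) := by
  have hD : DenomM X Z β ρ (alphaOf v) (gammaOf v) i j
      = ∑ ω, exp (dyadScores X Z β ρ v i j ω) := by
    simp [DenomM, dyadScores, dyadScore, Fintype.sum_prod_type]; ring
  rw [piDyad, hD, log_div (exp_pos _).ne' (sum_exp_pos _).ne', log_exp]
  rfl

lemma deriv_Lfun_line (v e : Fin n × Bool → ℝ) :
    deriv (fun s : ℝ => Lfun g X Z β ρ (v + s • e)) 0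
      = ∑ i, ∑ j ∈ univ.filter (fun j => i < j), (dyadEffect i j (g i j) (g j i) e
          - gibbsMean (dyadScores X Z β ρ v i j) (dyadEffects i j e)) := by
  refine HasDerivAt.deriv ?_
  unfold Lfun loglik
  refine HasDerivAt.fun_sum fun i _ => HasDerivAt.fun_sum fun j _ => ?_
  simp only [log_piDyad_s13, dyadScore_add, dyadScores_add, map_smul]
  refine HasDerivAt.fun_sub ?_ ?_
  · simpa using ((hasDerivAt_id (0 : ℝ)).mul_const
      (dyadEffect i j (g i j) (g j i) e)).const_add (dyadScore X Z β ρ v i j (g i j) (g j i))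
  · simpa using hasDerivAt_logPartition (dyadScores X Z β ρ v i j) (dyadEffects i j e) 0

lemma Hess_apply (v : Fin n × Bool → ℝ) (k l : Fin n × Bool) :
    Hess g X Z β ρ v k l = ∑ i, ∑ j ∈ univ.filter (fun j => i < j),
      -gibbsCov (dyadScores X Z β ρ v i j) (dyadEffects i j (Pi.single k 1))
        (dyadEffects i j (Pi.single l 1)) := by
  unfold Hess
  simp only [deriv_Lfun_line]
  refine HasDerivAt.deriv ?_
  refine HasDerivAt.fun_sum fun i _ => HasDerivAt.fun_sum fun j _ => ?_
  simp only [dyadScores_add, map_smul]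
  refine HasDerivAt.const_sub _ ?_
  simpa using hasDerivAt_gibbsMean (dyadScores X Z β ρ v i j)
    (dyadEffects i j (Pi.single k 1)) (dyadEffects i j (Pi.single l 1)) 0

lemma Hess_mulVec (v z : Fin n × Bool → ℝ) (k : Fin n × Bool) :
    (Hess g X Z β ρ v).mulVec z k = ∑ i, ∑ j ∈ univ.filter (fun j => i < j),
      -gibbsCov (dyadScores X Z β ρ v i j) (dyadEffects i j (Pi.single k 1))
        (dyadEffects i j z) := by
  have hz : ∀ i j, gibbsCov (dyadScores X Z β ρ v i j) (dyadEffects i j (Pi.single k 1))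
        (dyadEffects i j z)
      = ∑ l, gibbsCov (dyadScores X Z β ρ v i j) (dyadEffects i j (Pi.single k 1))
        (dyadEffects i j (Pi.single l 1)) * z l := fun i j => by
    have := ((gibbsCovLin (dyadScores X Z β ρ v i j)
      (dyadEffects i j (Pi.single k 1))).comp (dyadEffects i j)).pi_apply_eq_sum_univ z
    simp only [smul_eq_mul] at this
    refine this.trans (sum_congr rfl fun l _ => ?_)
    rw [mul_comm]
    have hl : (fun l' => if l = l' then (1 : ℝ) else 0) = Pi.single l 1 := by
      ext l'
      simp [Pi.single_apply, eq_comm]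
    rw [hl]
    rfl
  simp only [Matrix.mulVec, dotProduct, Hess_apply, hz, sum_mul, ← sum_neg_distrib, neg_mul]
  rw [sum_comm]
  exact sum_congr rfl fun i _ => sum_comm

end Likelihood

lemma alphaOf_single_nonneg (k : Fin n × Bool) (i : Fin (n + 1)) :
    0 ≤ alphaOf (Pi.single k 1) i := by
  unfold alphaOf; split
  · rfl
  · rw [Pi.single_apply]; split <;> simp

lemma gammaOf_single_nonneg (k : Fin n × Bool) (i : Fin (n + 1)) :
    0 ≤ gammaOf (Pi.single k 1) i := by
  unfold gammaOf; split
  · rfl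
  · rw [Pi.single_apply]; split <;> simp

lemma alphaOf_add_gammaOf_single (k : Fin n × Bool) (i : Fin (n + 1)) :
    alphaOf (Pi.single k 1) i + gammaOf (Pi.single k 1) i
      = if i = k.1.castSucc then 1 else 0 := by
  obtain ⟨m, b⟩ := k
  induction i using Fin.lastCases with
  | last => simp [alphaOf, gammaOf, (Fin.castSucc_lt_last m).ne']
  | cast i =>
    by_cases h : i = m <;> cases b <;>
      simp [alphaOf, gammaOf, (Fin.castSucc_lt_last i).ne, h]

lemma dyadEffects_single_mem (k : Fin n × Bool) (i j : Fin (n + 1)) (ω : Bool × Bool) :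
    0 ≤ dyadEffects i j (Pi.single k 1) ω ∧ dyadEffects i j (Pi.single k 1) ω
      ≤ (if i = k.1.castSucc then 1 else 0) + (if j = k.1.castSucc then 1 else 0) := by
  have h₁ := alphaOf_single_nonneg k i
  have h₂ := alphaOf_single_nonneg k j
  have h₃ := gammaOf_single_nonneg k i
  have h₄ := gammaOf_single_nonneg k j
  rw [← alphaOf_add_gammaOf_single, ← alphaOf_add_gammaOf_single]
  obtain ⟨a, b⟩ := ω
  cases a <;> cases b <;> simp [dyadEffects, dyadEffect_apply] <;>
    first
    | positivity
    | constructor <;> linarith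

lemma exists_abs_dyadEffects_sub_le (v : Fin n × Bool → ℝ) (i j : Fin (n + 1)) :
    ∃ m, ∀ ω, |dyadEffects i j v ω - m| ≤ 2 * ‖v‖ := by
  refine ⟨(alphaOf v i + gammaOf v j + (alphaOf v j + gammaOf v i)) / 2, fun ω => ?_⟩
  have h₁ := abs_le.1 (abs_alphaOf_le v i)
  have h₂ := abs_le.1 (abs_alphaOf_le v j)
  have h₃ := abs_le.1 (abs_gammaOf_le v i)
  have h₄ := abs_le.1 (abs_gammaOf_le v j)
  obtain ⟨a, b⟩ := ω
  cases a <;> cases b <;> simp [dyadEffects, dyadEffect_apply] <;> rw [abs_le] <;>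
    constructor <;> linarith

lemma sum_dyads_incident (m : Fin n) :
    ∑ i : Fin (n + 1), ∑ j ∈ univ.filter (fun j => i < j),
      (((if i = m.castSucc then 1 else 0) + (if j = m.castSucc then 1 else 0) : ℝ)) = n := by
  have h : ∀ i : Fin (n + 1), univ.filter (fun j => i < j) = Ioi i := fun i => by
    ext; simp
  have h' : univ.filter (fun i => i < m.castSucc) = Iio m.castSucc := by ext; simp
  simp only [sum_add_distrib, h]
  have h₁ : ∑ i : Fin (n + 1), ∑ j ∈ Ioi i, (if i = m.castSucc then 1 else 0 : ℝ)
      = ((n - m : ℕ) : ℝ) := by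
    simp
  have h₂ : ∑ i : Fin (n + 1), ∑ j ∈ Ioi i, (if j = m.castSucc then 1 else 0 : ℝ)
      = ((m : ℕ) : ℝ) := by
    simp [h']
  rw [h₁, h₂, ← Nat.cast_add, Nat.sub_add_cancel m.isLt.le]

end Dyads

theorem hessian_lipschitz_bound {n dx dz : ℕ} (hn : 1 ≤ n) (hdx : 1 ≤ dx) (hdz : 1 ≤ dz)
    (g : Fin (n + 1) → Fin (n + 1) → ℝ)
    (X : Fin (n + 1) → Fin (n + 1) → Fin dx → ℝ)
    (Z : Fin (n + 1) → Fin (n + 1) → Fin dz → ℝ)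
    (hgdiag : ∀ i, g i i = 0) (hg01 : ∀ i j, g i j = 0 ∨ g i j = 1)
    (hZsymm : ∀ i j, Z i j = Z j i)
    (β : Fin dx → ℝ) (ρ : Fin dz → ℝ)
    (x y z : Fin n × Bool → ℝ) :
    ‖(Hess g X Z β ρ x - Hess g X Z β ρ y).mulVec z‖
      ≤ 4 * n * ‖x - y‖ * ‖z‖ := by
  rw [pi_norm_le_iff_of_nonneg (by positivity)]
  intro k
  rw [Matrix.sub_mulVec, Pi.sub_apply, Hess_mulVec, Hess_mulVec, Real.norm_eq_abs,
    ← sum_sub_distrib]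
  simp only [← sum_sub_distrib]
  calc _ ≤ ∑ i, ∑ j ∈ univ.filter (fun j => i < j),
        ((if i = k.1.castSucc then 1 else 0) + (if j = k.1.castSucc then 1 else 0) : ℝ)
          * ((2 * ‖z‖) * (2 * ‖x - y‖)) := by
        refine (abs_sum_le_sum_abs _ _).trans (sum_le_sum fun i _ => ?_)
        refine (abs_sum_le_sum_abs _ _).trans (sum_le_sum fun j _ => ?_)
        obtain ⟨m, hm⟩ := exists_abs_dyadEffects_sub_le z i j
        obtain ⟨m', hm'⟩ := exists_abs_dyadEffects_sub_le (x - y) i j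
        have key := abs_gibbsCov_add_sub_le (dyadScores X Z β ρ y i j) _ _ _
          (fun ω => (dyadEffects_single_mem k i j ω).1)
          (fun ω => (dyadEffects_single_mem k i j ω).2) hm hm'
        rw [← dyadScores_add, add_sub_cancel] at key
        rwa [neg_sub_neg, abs_sub_comm]
    _ = 4 * n * ‖x - y‖ * ‖z‖ := by
        simp only [← sum_mul]
        rw [sum_dyads_incident]
        ring
end
end

section
/- Invariant-subspace formula for the inverse: let A be an invertible symmetric real m×m matrix and let U be an m×k real matrix with full column rank k whose column space is invariant under A (that is, A·U·c lies in the column space of U for every c ∈ ℝ^k). Then (i) the k×k matrix Uᵀ A U is invertible; (ii) U (Uᵀ A U)^{-1} Uᵀ = P A^{-1} P, where P = U (Uᵀ U)^{-1} Uᵀ is the orthogonal projection onto the column space of U; and (iii) A^{-1} = P A^{-1} P + (I − P) A^{-1} (I − P). -/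
/-!
STATEMENT 15: Invariant-subspace formula for the inverse: if A is an invertible
symmetric real m×m matrix and U an m×k matrix of full column rank whose column space
is invariant under A, then (i) Uᵀ A U is invertible; (ii) U (Uᵀ A U)⁻¹ Uᵀ = P A⁻¹ P,
where P = U (UᵀU)⁻¹ Uᵀ is the orthogonal projection onto the column space of U; and
(iii) A⁻¹ = P A⁻¹ P + (I − P) A⁻¹ (I − P).
-/

open Matrix

/-- A square matrix of full rank over a field has invertible determinant. -/
theorem Matrix.isUnit_det_of_rank_eq_card {n K : Type*} [Fintype n] [DecidableEq n] [Field K]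
    {A : Matrix n n K} (h : A.rank = Fintype.card n) : IsUnit A.det := by
  rw [← Matrix.isUnit_iff_isUnit_det, ← Matrix.mulVec_surjective_iff_isUnit]
  have htop : LinearMap.range A.mulVecLin = ⊤ :=
    Submodule.eq_top_of_finrank_eq (by rw [Module.finrank_fintype_fun_eq_card]; exact h)
  exact LinearMap.range_eq_top.mp htop

/-- If `A` maps the column space of `U` into itself, then `A * U` factors through `U`. -/
theorem Matrix.exists_mul_eq_mul_of_forall_mulVec {m n R : Type*} [Fintype m] [Fintype n]
    [CommSemiring R] {A : Matrix m m R} {U : Matrix m n R}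
    (h : ∀ c : n → R, ∃ c' : n → R, A *ᵥ (U *ᵥ c) = U *ᵥ c') :
    ∃ M : Matrix n n R, A * U = U * M := by
  classical
  choose f hf using h
  refine ⟨(Matrix.of fun j => f (Pi.single j 1))ᵀ, Matrix.ext_of_mulVec_single fun j => ?_⟩
  rw [← Matrix.mulVec_mulVec, ← Matrix.mulVec_mulVec, hf, Matrix.mulVec_single_one]
  rfl

/-- If `P * B` and `B * P` both equal `P * B * P`, then `B` is block diagonal with respect to
`P` and `1 - P`. -/
theorem eq_compress_add_compress_one_sub {R : Type*} [Ring R] {P B : R}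
    (hl : P * B = P * B * P) (hr : B * P = P * B * P) :
    B = P * B * P + (1 - P) * B * (1 - P) := by
  have h : (1 - P) * B * (1 - P) = B - P * B - B * P + P * B * P := by noncomm_ring
  rw [h, hl, hr, ← hl, ← hl]
  abel

theorem invariant_subspace_inverse_formula {m k : ℕ}
    (A : Matrix (Fin m) (Fin m) ℝ) (hAsymm : A.IsSymm) (hAunit : IsUnit A.det)
    (U : Matrix (Fin m) (Fin k) ℝ) (hUrank : U.rank = k)
    (hinvariant : ∀ c : Fin k → ℝ, ∃ c' : Fin k → ℝ,
      A.mulVec (U.mulVec c) = U.mulVec c') :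
    IsUnit (Uᵀ * A * U).det ∧
    U * (Uᵀ * A * U)⁻¹ * Uᵀ
      = (U * (Uᵀ * U)⁻¹ * Uᵀ) * A⁻¹ * (U * (Uᵀ * U)⁻¹ * Uᵀ) ∧
    A⁻¹ = (U * (Uᵀ * U)⁻¹ * Uᵀ) * A⁻¹ * (U * (Uᵀ * U)⁻¹ * Uᵀ)
        + (1 - U * (Uᵀ * U)⁻¹ * Uᵀ) * A⁻¹ * (1 - U * (Uᵀ * U)⁻¹ * Uᵀ) := by
  obtain ⟨M, hM⟩ := Matrix.exists_mul_eq_mul_of_forall_mulVec hinvariant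
  have hG : IsUnit (Uᵀ * U).det := Matrix.isUnit_det_of_rank_eq_card (by
    rw [Matrix.rank_transpose_mul_self, hUrank, Fintype.card_fin])
  have hMdet : IsUnit M.det := by
    refine Matrix.isUnit_det_of_rank_eq_card (le_antisymm M.rank_le_card_width ?_)
    calc Fintype.card (Fin k) = (U * M).rank := by
          rw [← hM, Matrix.rank_mul_eq_right_of_isUnit_det A U hAunit, hUrank, Fintype.card_fin]
      _ ≤ M.rank := Matrix.rank_mul_le_right U M
  have hUAU : Uᵀ * A * U = Uᵀ * U * M := by rw [Matrix.mul_assoc, hM, Matrix.mul_assoc]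
  have hAU : A⁻¹ * U = U * M⁻¹ := by
    calc A⁻¹ * U = A⁻¹ * (U * M) * M⁻¹ := by
          rw [← Matrix.mul_assoc, Matrix.mul_nonsing_inv_cancel_right _ _ hMdet]
      _ = U * M⁻¹ := by rw [← hM, Matrix.nonsing_inv_mul_cancel_left _ _ hAunit]
  set P := U * (Uᵀ * U)⁻¹ * Uᵀ with hP
  have hPU : P * U = U := by
    rw [hP, Matrix.mul_assoc, Matrix.nonsing_inv_mul_cancel_right _ _ hG]
  have hPsymm : Pᵀ = P := by
    simp [hP, Matrix.transpose_nonsing_inv, Matrix.mul_assoc]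
  have hAP : A⁻¹ * P = U * (M⁻¹ * (Uᵀ * U)⁻¹) * Uᵀ := by
    simp only [hP, ← Matrix.mul_assoc, hAU]
  have hr : A⁻¹ * P = P * A⁻¹ * P := by
    rw [Matrix.mul_assoc P, hAP, ← Matrix.mul_assoc P, ← Matrix.mul_assoc P, hPU]
  have hl : P * A⁻¹ = P * A⁻¹ * P := by
    simpa [Matrix.transpose_mul, Matrix.transpose_nonsing_inv, hPsymm, hAsymm.eq,
      Matrix.mul_assoc] using congrArg Matrix.transpose hr
  refine ⟨?_, ?_, eq_compress_add_compress_one_sub hl hr⟩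
  · rw [hUAU, Matrix.det_mul]
    exact hG.mul hMdet
  · rw [hUAU, Matrix.mul_inv_rev, ← hr, hAP]
end
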